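/- Let d ≥ 1 be an integer, let σ̃ ≥ 2/d and λ ≥ 0 be real numbers, let T > 0, and let u₀ ∈ 𝒮(ℝ^d; ℂ) satisfy V(u₀) + 4 T G(u₀) + 8 T² H_{σ̃,λ}(u₀) < 0. Then there is no map u : ℝ × ℝ^d → ℂ which is infinitely differentiable, satisfies for every multi-index α, every j ∈ {0,1} and every k ∈ ℕ that sup_{t∈[0,T], x∈ℝ^d} (1+|x|)^k |∂_t^j ∂_x^α u(t,x)| < ∞, satisfies i ∂_t u(t,x) = Δ_x u(t,x) + λ |u(t,x)|^{2σ̃} u(t,x) for all (t,x) ∈ [0,T] × ℝ^d, and has initial data u(0,·) = u₀. -/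

import Mathlib

open MeasureTheory Complex Filter Topology

noncomputable section

variable {d : ℕ}

/-- The `k`-th partial derivative of a function `u : ℝ^d → ℂ`. -/
def pd (u : EuclideanSpace ℝ (Fin d) → ℂ) (k : Fin d) (x : EuclideanSpace ℝ (Fin d)) : ℂ :=
  fderiv ℝ u x (EuclideanSpace.single k 1)

/-- The second partial derivative `∂_j ∂_k u` of a function `u : ℝ^d → ℂ`. -/
def pd2 (u : EuclideanSpace ℝ (Fin d) → ℂ) (j k : Fin d) (x : EuclideanSpace ℝ (Fin d)) : ℂ :=
  fderiv ℝ (fun y => fderiv ℝ u y (EuclideanSpace.single k 1)) x (EuclideanSpace.single j 1)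

/-- The Laplacian of a function `u : ℝ^d → ℂ`. -/
def lap (u : EuclideanSpace ℝ (Fin d) → ℂ) (x : EuclideanSpace ℝ (Fin d)) : ℂ :=
  ∑ k, pd2 u k k x

/-- The mass `M(v) = ∫ |v|² dx`. -/
def massM (v : EuclideanSpace ℝ (Fin d) → ℂ) : ℝ := ∫ x, ‖v x‖ ^ 2

/-- The energy `H_{σ̃,λ}(v) = (1/2) ∫ |∇v|² dx − (λ/(2σ̃+2)) ∫ |v|^{2σ̃+2} dx`. -/
def energyH (σt lam : ℝ) (v : EuclideanSpace ℝ (Fin d) → ℂ) : ℝ :=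
  (1 / 2) * (∫ x, ∑ k, ‖pd v k x‖ ^ 2)
    - (lam / (2 * σt + 2)) * ∫ x, ‖v x‖ ^ (2 * σt + 2)

/-- The variance `V(v) = ∫ |x|² |v(x)|² dx`. -/
def varV (v : EuclideanSpace ℝ (Fin d) → ℂ) : ℝ := ∫ x, ‖x‖ ^ 2 * ‖v x‖ ^ 2

/-- The momentum `G(v) = Im ∫ v (x·∇v̄) dx`. -/
def momG (v : EuclideanSpace ℝ (Fin d) → ℂ) : ℝ :=
  (∫ x, v x * ∑ k, (x k : ℂ) * (starRingEnd ℂ) (pd v k x)).im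

/-- `u`, together with its first time derivative, is rapidly decreasing in space,
uniformly on the time interval `[0, T]`: for every spatial multi-index (encoded via
the order `n` of the iterated spatial derivative), every `j ∈ {0,1}` and every `k`,
`sup_{t∈[0,T], x} (1+|x|)^k |∂_t^j ∂_x^α u(t,x)| < ∞`. -/
def RapidlyDecreasingOn (T : ℝ) (u : ℝ × EuclideanSpace ℝ (Fin d) → ℂ) : Prop :=
  ∀ n k : ℕ, ∃ C : ℝ, ∀ t ∈ Set.Icc (0 : ℝ) T, ∀ x,
    (1 + ‖x‖) ^ k * ‖iteratedFDeriv ℝ n (fun y => u (t, y)) x‖ ≤ C ∧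
    (1 + ‖x‖) ^ k * ‖iteratedFDeriv ℝ n (fun y => deriv (fun s => u (s, y)) t) x‖ ≤ C

/-- `u` is a classical solution on `[0, T]` of the nonlinear Schrödinger equation
`i ∂_t u = Δu + λ |u|^{2σ̃} u`. -/
def IsNLSSolution (σt lam T : ℝ) (u : ℝ × EuclideanSpace ℝ (Fin d) → ℂ) : Prop :=
  ∀ t ∈ Set.Icc (0 : ℝ) T, ∀ x,
    Complex.I * deriv (fun s => u (s, x)) t
      = lap (fun y => u (t, y)) x
        + ((lam * ‖u (t, x)‖ ^ (2 * σt) : ℝ) : ℂ) * u (t, x)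


/-- A time-dependent function on `ℝ^d` which is continuous in space and decreases in space faster
than any polynomial, uniformly for times in `[0, T]`. -/
structure UniformDecay (T : ℝ) (f : ℝ → EuclideanSpace ℝ (Fin d) → ℝ) : Prop where
  continuous : ∀ t ∈ Set.Icc 0 T, Continuous (f t)
  decay : ∀ k : ℕ, ∃ C : ℝ, ∀ t ∈ Set.Icc 0 T, ∀ x, (1 + ‖x‖) ^ k * |f t x| ≤ C

namespace UniformDecay

variable {T : ℝ} {f g : ℝ → EuclideanSpace ℝ (Fin d) → ℝ}

lemma congr (hf : UniformDecay T f) (h : ∀ t ∈ Set.Icc 0 T, ∀ x, g t x = f t x) :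
    UniformDecay T g where
  continuous t ht := by
    rw [funext (h t ht)]
    exact hf.continuous t ht
  decay k := by
    obtain ⟨C, hC⟩ := hf.decay k
    exact ⟨C, fun t ht x => by rw [h t ht x]; exact hC t ht x⟩

lemma zero : UniformDecay T (fun _ (_ : EuclideanSpace ℝ (Fin d)) => 0) where
  continuous _ _ := continuous_const
  decay _ := ⟨0, by simp⟩

lemma add (hf : UniformDecay T f) (hg : UniformDecay T g) :
    UniformDecay T (fun t x => f t x + g t x) where
  continuous t ht := (hf.continuous t ht).add (hg.continuous t ht)
  decay k := by
    obtain ⟨C, hC⟩ := hf.decay k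
    obtain ⟨C', hC'⟩ := hg.decay k
    refine ⟨C + C', fun t ht x => ?_⟩
    calc (1 + ‖x‖) ^ k * |f t x + g t x| ≤ (1 + ‖x‖) ^ k * (|f t x| + |g t x|) := by
          gcongr
          exact abs_add_le _ _
      _ ≤ C + C' := by
          rw [mul_add]
          exact add_le_add (hC t ht x) (hC' t ht x)

lemma bounded_mul (hf : UniformDecay T f) {C₀ : ℝ} (hg : ∀ t ∈ Set.Icc 0 T, Continuous (g t))
    (hC₀ : ∀ t ∈ Set.Icc 0 T, ∀ x, |g t x| ≤ C₀) :
    UniformDecay T (fun t x => g t x * f t x) where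
  continuous t ht := (hg t ht).mul (hf.continuous t ht)
  decay k := by
    obtain ⟨C, hC⟩ := hf.decay k
    refine ⟨C₀ * C, fun t ht x => ?_⟩
    rw [abs_mul, mul_left_comm]
    exact mul_le_mul (hC₀ t ht x) (hC t ht x) (by positivity)
      ((abs_nonneg _).trans (hC₀ t ht x))

lemma exists_bound (hf : UniformDecay T f) :
    ∃ C : ℝ, ∀ t ∈ Set.Icc 0 T, ∀ x, |f t x| ≤ C := by
  simpa using hf.decay 0

lemma mul (hf : UniformDecay T f) (hg : UniformDecay T g) :
    UniformDecay T (fun t x => f t x * g t x) := by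
  obtain ⟨C, hC⟩ := hf.exists_bound
  exact hg.bounded_mul hf.continuous hC

lemma const_mul (c : ℝ) (hf : UniformDecay T f) : UniformDecay T (fun t x => c * f t x) :=
  hf.bounded_mul (C₀ := |c|) (fun _ _ => continuous_const) (fun _ _ _ => le_rfl)

lemma neg (hf : UniformDecay T f) : UniformDecay T (fun t x => -f t x) :=
  (hf.const_mul (-1)).congr fun _ _ _ => by ring

lemma sub (hf : UniformDecay T f) (hg : UniformDecay T g) :
    UniformDecay T (fun t x => f t x - g t x) :=
  (hf.add hg.neg).congr fun _ _ _ => by ring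

lemma pow_two (hf : UniformDecay T f) : UniformDecay T (fun t x => f t x ^ 2) :=
  (hf.mul hf).congr fun _ _ _ => by ring

lemma sum {ι : Type*} {s : Finset ι} {F : ι → ℝ → EuclideanSpace ℝ (Fin d) → ℝ}
    (hF : ∀ i, UniformDecay T (F i)) : UniformDecay T (fun t x => ∑ i ∈ s, F i t x) := by
  classical
  induction s using Finset.induction_on with
  | empty => simpa using zero
  | insert i s hi ih => exact ((hF i).add ih).congr fun _ _ _ => Finset.sum_insert hi

lemma polynomial_mul (hf : UniformDecay T f) {h : EuclideanSpace ℝ (Fin d) → ℝ}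
    (hh : Continuous h) (m : ℕ) (hm : ∀ x, |h x| ≤ (1 + ‖x‖) ^ m) :
    UniformDecay T (fun t x => h x * f t x) where
  continuous t ht := hh.mul (hf.continuous t ht)
  decay k := by
    obtain ⟨C, hC⟩ := hf.decay (k + m)
    refine ⟨C, fun t ht x => ?_⟩
    calc (1 + ‖x‖) ^ k * |h x * f t x| ≤ (1 + ‖x‖) ^ k * ((1 + ‖x‖) ^ m * |f t x|) := by
          rw [abs_mul]
          gcongr
          exact hm x
      _ = (1 + ‖x‖) ^ (k + m) * |f t x| := by ring
      _ ≤ C := hC t ht x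

lemma coord_mul (hf : UniformDecay T f) (k : Fin d) : UniformDecay T (fun t x => x k * f t x) :=
  hf.polynomial_mul (by fun_prop) 1 fun x => by
    have := PiLp.norm_apply_le x k
    rw [Real.norm_eq_abs] at this
    linarith

lemma normSq_mul (hf : UniformDecay T f) : UniformDecay T (fun t x => ‖x‖ ^ 2 * f t x) :=
  hf.polynomial_mul (by fun_prop) 2 fun x => by
    rw [abs_of_nonneg (by positivity)]
    gcongr
    linarith

lemma rpow_mul_self (hf : UniformDecay T f) (hf₀ : ∀ t ∈ Set.Icc 0 T, ∀ x, 0 ≤ f t x) {σ : ℝ}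
    (hσ : 0 ≤ σ) : UniformDecay T (fun t x => f t x ^ σ * f t x) := by
  obtain ⟨C, hC⟩ := hf.exists_bound
  refine hf.bounded_mul (C₀ := C ^ σ) (fun t ht => (hf.continuous t ht).rpow_const fun _ => .inr hσ)
    fun t ht x => ?_
  have h₀ := hf₀ t ht x
  rw [abs_of_nonneg (by positivity)]
  exact Real.rpow_le_rpow h₀ ((le_abs_self _).trans (hC t ht x)) hσ

lemma exists_integrable_bound (hf : UniformDecay T f) :
    ∃ B : EuclideanSpace ℝ (Fin d) → ℝ, Integrable B ∧
      ∀ t ∈ Set.Icc 0 T, ∀ x, ‖f t x‖ ≤ B x := by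
  obtain ⟨C, hC⟩ := hf.decay (d + 1)
  refine ⟨fun x => C * (1 + ‖x‖) ^ (-((d + 1 : ℕ) : ℝ)), ?_, fun t ht x => ?_⟩
  · refine (integrable_one_add_norm ?_).const_mul C
    simp
  · have hx : 0 < (1 + ‖x‖) ^ (d + 1) := by positivity
    beta_reduce
    rw [Real.rpow_neg (by positivity), Real.rpow_natCast, ← div_eq_mul_inv, le_div_iff₀ hx,
      mul_comm, Real.norm_eq_abs]
    exact hC t ht x

lemma integrable (hf : UniformDecay T f) {t : ℝ} (ht : t ∈ Set.Icc 0 T) : Integrable (f t) := by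
  obtain ⟨B, hB, hfB⟩ := hf.exists_integrable_bound
  exact hB.mono' (hf.continuous t ht).aestronglyMeasurable (.of_forall (hfB t ht))

end UniformDecay

lemma integral_eq_zero_of_hasLineDerivAt {E : Type*} [NormedAddCommGroup E] [NormedSpace ℝ E]
    [FiniteDimensional ℝ E] [MeasurableSpace E] [BorelSpace E] {μ : Measure E}
    [μ.IsAddHaarMeasure] {F D : E → ℝ} {v : E}
    (hF : Integrable F μ) (hD : Integrable D μ) (h : ∀ x, HasLineDerivAt ℝ F (D x) x v) :
    ∫ x, D x ∂μ = 0 := by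
  have := integral_bilinear_hasLineDerivAt_right_eq_neg_left_of_integrable (μ := μ)
    (f := fun _ => (1 : ℝ)) (f' := fun _ => 0) (g := F) (g' := D) (v := v)
    (B := ContinuousLinearMap.mul ℝ ℝ) (by simp) (by simpa using hD) (by simpa using hF)
    (fun x _ => by simpa [HasLineDerivAt] using hasDerivAt_const (0 : ℝ) (1 : ℝ)) (fun x _ => h x)
  simpa using this

/-- The integrated form of a balance law `∂ₜ f = g + ∑ₖ ∂ₖ Fₖ` with rapidly decreasing terms. -/
lemma hasDerivAt_integral_of_balance_law {T : ℝ} {f g : ℝ → EuclideanSpace ℝ (Fin d) → ℝ}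
    {F D : Fin d → ℝ → EuclideanSpace ℝ (Fin d) → ℝ}
    (hf : UniformDecay T f) (hg : UniformDecay T g)
    (hF : ∀ k, UniformDecay T (F k)) (hD : ∀ k, UniformDecay T (D k))
    (hFD : ∀ k, ∀ t ∈ Set.Icc 0 T, ∀ x,
      HasLineDerivAt ℝ (F k t) (D k t x) x (EuclideanSpace.single k 1))
    (hfg : ∀ t ∈ Set.Icc 0 T, ∀ x, HasDerivAt (fun s => f s x) (g t x + ∑ k, D k t x) t) :
    ContinuousOn (fun t => ∫ x, f t x) (Set.Icc 0 T) ∧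
      ∀ t ∈ Set.Ioo 0 T, HasDerivAt (fun t => ∫ x, f t x) (∫ x, g t x) t := by
  constructor
  · obtain ⟨B, hB, hfB⟩ := hf.exists_integrable_bound
    exact continuousOn_of_dominated (fun t ht => (hf.continuous t ht).aestronglyMeasurable)
      (fun t ht => .of_forall (hfB t ht)) hB
      (.of_forall fun x t ht => (hfg t ht x).continuousAt.continuousWithinAt)
  · intro t ht
    have ht' := Set.Ioo_subset_Icc_self ht
    have hf' := hg.add (UniformDecay.sum (s := Finset.univ) hD)
    obtain ⟨B, hB, hfB⟩ := hf'.exists_integrable_bound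
    have key := (hasDerivAt_integral_of_dominated_loc_of_deriv_le (μ := volume) (F := f)
      (Icc_mem_nhds ht.1 ht.2)
      (by filter_upwards [Icc_mem_nhds ht.1 ht.2] with s hs using
            (hf.continuous s hs).aestronglyMeasurable)
      (hf.integrable ht') (hf'.continuous t ht').aestronglyMeasurable
      (.of_forall fun x s hs => hfB s hs x) hB (.of_forall fun x s hs => hfg s hs x)).2
    have hdiv : ∫ x, ∑ k, D k t x = 0 := by
      rw [integral_finsetSum _ fun k _ => (hD k).integrable ht']
      exact Finset.sum_eq_zero fun k _ => integral_eq_zero_of_hasLineDerivAt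
        ((hF k).integrable ht') ((hD k).integrable ht') (hFD k t ht')
    rwa [integral_add (hg.integrable ht')
      ((UniformDecay.sum (s := Finset.univ) hD).integrable ht'), hdiv, add_zero] at key

/-- `a` is a smooth enough real function of `(t, x)` with spatial gradient `da`, spatial Hessian
`dda`, time derivative `a'` and gradient of the time derivative `da'`, all of them rapidly
decreasing uniformly on `[0, T]`. -/
structure DecayingJet (T : ℝ) (a : ℝ → EuclideanSpace ℝ (Fin d) → ℝ)
    (da : Fin d → ℝ → EuclideanSpace ℝ (Fin d) → ℝ)
    (dda : Fin d → Fin d → ℝ → EuclideanSpace ℝ (Fin d) → ℝ)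
    (a' : ℝ → EuclideanSpace ℝ (Fin d) → ℝ)
    (da' : Fin d → ℝ → EuclideanSpace ℝ (Fin d) → ℝ) : Prop where
  decay : UniformDecay T a
  decay_grad : ∀ k, UniformDecay T (da k)
  decay_hess : ∀ j k, UniformDecay T (dda j k)
  decay_time : UniformDecay T a'
  decay_time_grad : ∀ k, UniformDecay T (da' k)
  hasDerivAt : ∀ t x, HasDerivAt (fun s => a s x) (a' t x) t
  hasDerivAt_grad : ∀ k t x, HasDerivAt (fun s => da k s x) (da' k t x) t
  hasLineDerivAt : ∀ k t x, HasLineDerivAt ℝ (a t) (da k t x) x (EuclideanSpace.single k 1)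
  hasLineDerivAt_grad : ∀ j k t x,
    HasLineDerivAt ℝ (da k t) (dda j k t x) x (EuclideanSpace.single j 1)
  hasLineDerivAt_time : ∀ k t x,
    HasLineDerivAt ℝ (a' t) (da' k t x) x (EuclideanSpace.single k 1)
  symm : ∀ j k t x, dda j k t x = dda k j t x

lemma hasLineDerivAt_coord (j k : Fin d) (x : EuclideanSpace ℝ (Fin d)) :
    HasLineDerivAt ℝ (fun y : EuclideanSpace ℝ (Fin d) => y j) (if j = k then 1 else 0) x
      (EuclideanSpace.single k 1) := by
  have := ((hasDerivAt_id (0 : ℝ)).mul_const (if j = k then (1 : ℝ) else 0)).const_add (x j)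
  simpa [HasLineDerivAt, PiLp.single_apply] using this

lemma hasLineDerivAt_norm_sq (k : Fin d) (x : EuclideanSpace ℝ (Fin d)) :
    HasLineDerivAt ℝ (fun y : EuclideanSpace ℝ (Fin d) => ‖y‖ ^ 2) (2 * x k) x
      (EuclideanSpace.single k 1) := by
  have := ((hasStrictFDerivAt_norm_sq x).hasFDerivAt).hasLineDerivAt
    (EuclideanSpace.single k (1 : ℝ))
  simpa [EuclideanSpace.inner_single_right] using this

section RealSystem

variable {T σ lam : ℝ} {a b : ℝ → EuclideanSpace ℝ (Fin d) → ℝ}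
  {da db : Fin d → ℝ → EuclideanSpace ℝ (Fin d) → ℝ}
  {dda ddb : Fin d → Fin d → ℝ → EuclideanSpace ℝ (Fin d) → ℝ}
  {a' b' : ℝ → EuclideanSpace ℝ (Fin d) → ℝ}
  {da' db' : Fin d → ℝ → EuclideanSpace ℝ (Fin d) → ℝ}

theorem variance_law (ha : DecayingJet T a da dda a' da') (hb : DecayingJet T b db ddb b' db')
    {R : ℝ → EuclideanSpace ℝ (Fin d) → ℝ}
    (hat : ∀ t ∈ Set.Icc 0 T, ∀ x, a' t x = ∑ k, ddb k k t x + R t x * b t x)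
    (hbt : ∀ t ∈ Set.Icc 0 T, ∀ x, b' t x = -(∑ k, dda k k t x + R t x * a t x)) :
    ContinuousOn (fun t => ∫ x, ‖x‖ ^ 2 * (a t x ^ 2 + b t x ^ 2)) (Set.Icc 0 T) ∧
      ∀ t ∈ Set.Ioo 0 T, HasDerivAt (fun t => ∫ x, ‖x‖ ^ 2 * (a t x ^ 2 + b t x ^ 2))
        (∫ x, 4 * ∑ k, x k * (b t x * da k t x - a t x * db k t x)) t := by
  refine hasDerivAt_integral_of_balance_law
    (F := fun k t x => 2 * (‖x‖ ^ 2 * (a t x * db k t x - b t x * da k t x)))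
    (D := fun k t x => 4 * (x k * (a t x * db k t x - b t x * da k t x)) +
      2 * (‖x‖ ^ 2 * (a t x * ddb k k t x - b t x * dda k k t x)))
    (ha.decay.pow_two.add hb.decay.pow_two).normSq_mul ?_ (fun k => ?_) (fun k => ?_)
    (fun k t ht x => ?_) (fun t ht x => ?_)
  · exact .const_mul _ (.sum fun k => ((hb.decay.mul (ha.decay_grad k)).sub
      (ha.decay.mul (hb.decay_grad k))).coord_mul k)
  · exact ((ha.decay.mul (hb.decay_grad k)).sub
      (hb.decay.mul (ha.decay_grad k))).normSq_mul.const_mul _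
  · exact ((((ha.decay.mul (hb.decay_grad k)).sub
      (hb.decay.mul (ha.decay_grad k))).coord_mul k).const_mul _).add
      (((ha.decay.mul (hb.decay_hess k k)).sub
      (hb.decay.mul (ha.decay_hess k k))).normSq_mul.const_mul _)
  · have h₁ := ha.hasLineDerivAt k t x
    have h₂ := hb.hasLineDerivAt k t x
    have h₃ := ha.hasLineDerivAt_grad k k t x
    have h₄ := hb.hasLineDerivAt_grad k k t x
    have h₅ := hasLineDerivAt_norm_sq k x
    unfold HasLineDerivAt at *
    refine ((h₅.fun_mul ((h₁.fun_mul h₄).fun_sub (h₂.fun_mul h₃))).const_mul 2).congr_deriv ?_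
    simp only [zero_smul, add_zero]
    ring
  · refine ((((ha.hasDerivAt t x).fun_pow 2).fun_add
      ((hb.hasDerivAt t x).fun_pow 2)).const_mul (‖x‖ ^ 2)).congr_deriv ?_
    rw [hat t ht x, hbt t ht x]
    have h₁ : ∑ k, x k * (a t x * db k t x - b t x * da k t x) =
        -∑ k, x k * (b t x * da k t x - a t x * db k t x) := by
      rw [← Finset.sum_neg_distrib]
      exact Finset.sum_congr rfl fun k _ => by ring
    simp only [Finset.sum_add_distrib, ← Finset.mul_sum, Finset.sum_sub_distrib] at h₁ ⊢
    push_cast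
    linear_combination (-4) * h₁

/-- Derivative of a power of a sum of two squares. -/
lemma HasDerivAt.sq_add_sq_rpow {f g : ℝ → ℝ} {f' g' s : ℝ} (hσ : 0 ≤ σ)
    (hf : HasDerivAt f f' s) (hg : HasDerivAt g g' s) :
    HasDerivAt (fun r => (f r ^ 2 + g r ^ 2) ^ σ * (f r ^ 2 + g r ^ 2))
      ((σ + 1) * ((f s ^ 2 + g s ^ 2) ^ σ * (2 * (f s * f' + g s * g')))) s := by
  have h := ((hf.fun_pow 2).fun_add (hg.fun_pow 2)).rpow_const (p := σ + 1) (.inr (by linarith))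
  have h' : (fun r => (f r ^ 2 + g r ^ 2) ^ σ * (f r ^ 2 + g r ^ 2)) =
      fun r => (f r ^ 2 + g r ^ 2) ^ (σ + 1) := by
    funext r
    rw [Real.rpow_add_one' (by positivity) (by linarith)]
  rw [h']
  refine h.congr_deriv ?_
  rw [add_sub_cancel_right]
  push_cast
  ring

theorem energy_law (hσ : 0 ≤ σ) (ha : DecayingJet T a da dda a' da')
    (hb : DecayingJet T b db ddb b' db')
    (hat : ∀ t ∈ Set.Icc 0 T, ∀ x, a' t x =
      ∑ k, ddb k k t x + lam * (a t x ^ 2 + b t x ^ 2) ^ σ * b t x)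
    (hbt : ∀ t ∈ Set.Icc 0 T, ∀ x, b' t x =
      -(∑ k, dda k k t x + lam * (a t x ^ 2 + b t x ^ 2) ^ σ * a t x)) :
    ContinuousOn (fun t => ∫ x, ((1 / 2) * (∑ k, (da k t x ^ 2 + db k t x ^ 2)) -
        lam / (2 * σ + 2) * ((a t x ^ 2 + b t x ^ 2) ^ σ * (a t x ^ 2 + b t x ^ 2))))
        (Set.Icc 0 T) ∧
      ∀ t ∈ Set.Ioo 0 T, HasDerivAt
        (fun t => ∫ x, ((1 / 2) * (∑ k, (da k t x ^ 2 + db k t x ^ 2)) -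
          lam / (2 * σ + 2) * ((a t x ^ 2 + b t x ^ 2) ^ σ * (a t x ^ 2 + b t x ^ 2))))
        (∫ _ : EuclideanSpace ℝ (Fin d), 0) t := by
  refine hasDerivAt_integral_of_balance_law (g := fun _ _ => 0)
    (F := fun k t x => da k t x * a' t x + db k t x * b' t x)
    (D := fun k t x => dda k k t x * a' t x + da k t x * da' k t x +
      (ddb k k t x * b' t x + db k t x * db' k t x))
    ?_ .zero (fun k => ?_) (fun k => ?_) (fun k t ht x => ?_) (fun t ht x => ?_)
  · exact (UniformDecay.const_mul _ (.sum fun k =>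
      (ha.decay_grad k).pow_two.add (hb.decay_grad k).pow_two)).sub
      (((ha.decay.pow_two.add hb.decay.pow_two).rpow_mul_self
        (fun _ _ _ => by positivity) hσ).const_mul _)
  · exact ((ha.decay_grad k).mul ha.decay_time).add ((hb.decay_grad k).mul hb.decay_time)
  · exact (((ha.decay_hess k k).mul ha.decay_time).add
      ((ha.decay_grad k).mul (ha.decay_time_grad k))).add
      (((hb.decay_hess k k).mul hb.decay_time).add ((hb.decay_grad k).mul (hb.decay_time_grad k)))
  · have h₁ := ha.hasLineDerivAt_time k t x
    have h₂ := hb.hasLineDerivAt_time k t x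
    have h₃ := ha.hasLineDerivAt_grad k k t x
    have h₄ := hb.hasLineDerivAt_grad k k t x
    unfold HasLineDerivAt at *
    refine ((h₃.fun_mul h₁).fun_add (h₄.fun_mul h₂)).congr_deriv ?_
    simp only [zero_smul, add_zero]
  · refine (((HasDerivAt.fun_sum fun k _ => ((ha.hasDerivAt_grad k t x).fun_pow 2).fun_add
      ((hb.hasDerivAt_grad k t x).fun_pow 2)).const_mul (1 / 2)).fun_sub
      (((ha.hasDerivAt t x).sq_add_sq_rpow hσ (hb.hasDerivAt t x)).const_mul
        (lam / (2 * σ + 2)))).congr_deriv ?_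
    have h₁ := hat t ht x
    have h₂ := hbt t ht x
    have h₃ : (1 / 2 : ℝ) * ∑ k, (((2 : ℕ) : ℝ) * da k t x ^ (2 - 1) * da' k t x +
        ((2 : ℕ) : ℝ) * db k t x ^ (2 - 1) * db' k t x) =
        ∑ k, da k t x * da' k t x + ∑ k, db k t x * db' k t x := by
      rw [← Finset.sum_add_distrib, Finset.mul_sum]
      exact Finset.sum_congr rfl fun k _ => by push_cast; ring
    have h₄ : lam / (2 * σ + 2) * (σ + 1) = lam / 2 := by
      field_simp
    rw [h₃]
    simp only [Finset.sum_add_distrib, ← Finset.sum_mul]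
    linear_combination (-2) * (a t x ^ 2 + b t x ^ 2) ^ σ *
      (a t x * a' t x + b t x * b' t x) * h₄ + b' t x * h₁ - a' t x * h₂

theorem momentum_law (hσ : 0 ≤ σ) (ha : DecayingJet T a da dda a' da')
    (hb : DecayingJet T b db ddb b' db')
    (hat : ∀ t ∈ Set.Icc 0 T, ∀ x, a' t x =
      ∑ k, ddb k k t x + lam * (a t x ^ 2 + b t x ^ 2) ^ σ * b t x)
    (hbt : ∀ t ∈ Set.Icc 0 T, ∀ x, b' t x =
      -(∑ k, dda k k t x + lam * (a t x ^ 2 + b t x ^ 2) ^ σ * a t x)) :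
    ContinuousOn (fun t => ∫ x, ∑ k, x k * (b t x * da k t x - a t x * db k t x))
        (Set.Icc 0 T) ∧
      ∀ t ∈ Set.Ioo 0 T, HasDerivAt
        (fun t => ∫ x, ∑ k, x k * (b t x * da k t x - a t x * db k t x))
        (∫ x, (2 * (∑ k, (da k t x ^ 2 + db k t x ^ 2)) -
          d * lam * σ / (σ + 1) *
            ((a t x ^ 2 + b t x ^ 2) ^ σ * (a t x ^ 2 + b t x ^ 2)))) t := by
  have hP := (ha.decay.pow_two.add hb.decay.pow_two).rpow_mul_self
    (fun _ _ _ => by positivity) hσ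
  have hQ : UniformDecay T (fun t x => ∑ j, (da j t x ^ 2 + db j t x ^ 2)) :=
    .sum fun j => (ha.decay_grad j).pow_two.add (hb.decay_grad j).pow_two
  have hXa : UniformDecay T (fun t x => ∑ j, x j * da j t x) :=
    .sum fun j => (ha.decay_grad j).coord_mul j
  have hXb : UniformDecay T (fun t x => ∑ j, x j * db j t x) :=
    .sum fun j => (hb.decay_grad j).coord_mul j
  refine hasDerivAt_integral_of_balance_law
    (F := fun k t x => x k * (b t x * a' t x - a t x * b' t x)
      - d * (a t x * da k t x + b t x * db k t x)
      - 2 * ((∑ j, x j * da j t x) * da k t x + (∑ j, x j * db j t x) * db k t x)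
      + x k * ∑ j, (da j t x ^ 2 + db j t x ^ 2)
      - lam / (σ + 1) * (x k * ((a t x ^ 2 + b t x ^ 2) ^ σ * (a t x ^ 2 + b t x ^ 2))))
    (D := fun k t x => (b t x * a' t x - a t x * b' t x)
      + x k * (db k t x * a' t x + b t x * da' k t x - (da k t x * b' t x + a t x * db' k t x))
      - d * (da k t x ^ 2 + a t x * dda k k t x + (db k t x ^ 2 + b t x * ddb k k t x))
      - 2 * ((da k t x + ∑ j, x j * dda k j t x) * da k t x +
          (∑ j, x j * da j t x) * dda k k t x +
        ((db k t x + ∑ j, x j * ddb k j t x) * db k t x +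
          (∑ j, x j * db j t x) * ddb k k t x))
      + ∑ j, (da j t x ^ 2 + db j t x ^ 2)
      + x k * (2 * ∑ j, (da j t x * dda k j t x + db j t x * ddb k j t x))
      - lam / (σ + 1) * ((a t x ^ 2 + b t x ^ 2) ^ σ * (a t x ^ 2 + b t x ^ 2))
      - 2 * lam * (x k * ((a t x ^ 2 + b t x ^ 2) ^ σ *
          (a t x * da k t x + b t x * db k t x))))
    ?_ ?_ (fun k => ?_) (fun k => ?_) (fun k t ht x => ?_) (fun t ht x => ?_)
  · exact .sum fun k => ((hb.decay.mul (ha.decay_grad k)).sub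
      (ha.decay.mul (hb.decay_grad k))).coord_mul k
  · exact (hQ.const_mul _).sub (hP.const_mul _)
  · exact ((((((hb.decay.mul ha.decay_time).sub (ha.decay.mul hb.decay_time)).coord_mul k).sub
      (((ha.decay.mul (ha.decay_grad k)).add (hb.decay.mul (hb.decay_grad k))).const_mul _)).sub
      (((hXa.mul (ha.decay_grad k)).add (hXb.mul (hb.decay_grad k))).const_mul _)).add
      (hQ.coord_mul k)).sub ((hP.coord_mul k).const_mul _)
  · have hS : UniformDecay T (fun t x => (a t x ^ 2 + b t x ^ 2) ^ σ *
        (a t x * da k t x + b t x * db k t x)) := by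
      obtain ⟨C, hC⟩ := (ha.decay.pow_two.add hb.decay.pow_two).exists_bound
      refine UniformDecay.bounded_mul (C₀ := C ^ σ) ((ha.decay.mul (ha.decay_grad k)).add
        (hb.decay.mul (hb.decay_grad k))) (fun t ht => ?_) fun t ht x => ?_
      · exact ((ha.decay.pow_two.add hb.decay.pow_two).continuous t ht).rpow_const
          fun _ => .inr hσ
      · rw [abs_of_nonneg (by positivity)]
        exact Real.rpow_le_rpow (by positivity) ((le_abs_self _).trans (hC t ht x)) hσ
    have hHa : UniformDecay T (fun t x => ∑ j, x j * dda k j t x) :=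
      .sum fun j => (ha.decay_hess k j).coord_mul j
    have hHb : UniformDecay T (fun t x => ∑ j, x j * ddb k j t x) :=
      .sum fun j => (hb.decay_hess k j).coord_mul j
    have hM : UniformDecay T (fun t x => ∑ j, (da j t x * dda k j t x + db j t x * ddb k j t x)) :=
      .sum fun j => ((ha.decay_grad j).mul (ha.decay_hess k j)).add
        ((hb.decay_grad j).mul (hb.decay_hess k j))
    exact ((((((((hb.decay.mul ha.decay_time).sub (ha.decay.mul hb.decay_time)).add
      (((((hb.decay_grad k).mul ha.decay_time).add (hb.decay.mul (ha.decay_time_grad k))).sub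
        (((ha.decay_grad k).mul hb.decay_time).add
          (ha.decay.mul (hb.decay_time_grad k)))).coord_mul k)).sub
      ((((ha.decay_grad k).pow_two.add (ha.decay.mul (ha.decay_hess k k))).add
        ((hb.decay_grad k).pow_two.add (hb.decay.mul (hb.decay_hess k k)))).const_mul _)).sub
      ((((((ha.decay_grad k).add hHa).mul (ha.decay_grad k)).add
          (hXa.mul (ha.decay_hess k k))).add
        ((((hb.decay_grad k).add hHb).mul (hb.decay_grad k)).add
          (hXb.mul (hb.decay_hess k k)))).const_mul _)).add hQ).add
      ((hM.const_mul _).coord_mul k)).sub (hP.const_mul _)).sub ((hS.coord_mul k).const_mul _)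
  · have h₁ := ha.hasLineDerivAt k t x
    have h₂ := hb.hasLineDerivAt k t x
    have h₃ := fun j => ha.hasLineDerivAt_grad k j t x
    have h₄ := fun j => hb.hasLineDerivAt_grad k j t x
    have h₅ := fun j => hasLineDerivAt_coord j k x
    have h₆ := ha.hasLineDerivAt_time k t x
    have h₇ := hb.hasLineDerivAt_time k t x
    unfold HasLineDerivAt at *
    refine (((((h₅ k).fun_mul ((h₂.fun_mul h₆).fun_sub (h₁.fun_mul h₇))).fun_sub
      (((h₁.fun_mul (h₃ k)).fun_add (h₂.fun_mul (h₄ k))).const_mul (d : ℝ))).fun_sub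
      ((((HasDerivAt.fun_sum fun j _ => (h₅ j).fun_mul (h₃ j)).fun_mul (h₃ k)).fun_add
        ((HasDerivAt.fun_sum fun j _ => (h₅ j).fun_mul (h₄ j)).fun_mul (h₄ k))).const_mul
        2)).fun_add
      ((h₅ k).fun_mul (HasDerivAt.fun_sum fun j _ =>
        ((h₃ j).fun_pow 2).fun_add ((h₄ j).fun_pow 2)))).fun_sub
      (((h₅ k).fun_mul (h₁.sq_add_sq_rpow hσ h₂)).const_mul (lam / (σ + 1)))
      |>.congr_deriv ?_
    have h₈ : lam / (σ + 1) * (σ + 1) = lam := by field_simp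
    have h₉ : ∑ j, (2 * da j t x * dda k j t x + 2 * db j t x * ddb k j t x) =
        2 * ∑ j, (da j t x * dda k j t x + db j t x * ddb k j t x) := by
      rw [Finset.mul_sum]
      exact Finset.sum_congr rfl fun j _ => by ring
    have h₁₀ : ∀ c w : Fin d → ℝ,
        ∑ j, ((if j = k then 1 else 0) * c j + w j) = c k + ∑ j, w j := fun c w => by
      simp [Finset.sum_add_distrib]
    simp only [zero_smul, add_zero, if_true, Nat.cast_ofNat, Nat.add_one_sub_one, pow_one, h₉, h₁₀]
    linear_combination (-2) * x k * ((a t x ^ 2 + b t x ^ 2) ^ σ *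
          (a t x * da k t x + b t x * db k t x)) * h₈
  · refine (HasDerivAt.fun_sum fun k _ =>
      (((hb.hasDerivAt t x).fun_mul (ha.hasDerivAt_grad k t x)).fun_sub
        ((ha.hasDerivAt t x).fun_mul (hb.hasDerivAt_grad k t x))).const_mul (x k)).congr_deriv ?_
    have h₁ := hat t ht x
    have h₂ := hbt t ht x
    obtain ⟨q, hq⟩ : ∃ q : Fin d → ℝ, ∀ k, q k = da k t x ^ 2 + db k t x ^ 2 :=
      ⟨_, fun _ => rfl⟩
    obtain ⟨m, hm⟩ : ∃ m : Fin d → ℝ, ∀ k, m k =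
        x k * ∑ j, (da j t x * dda k j t x + db j t x * ddb k j t x) := ⟨_, fun _ => rfl⟩
    obtain ⟨n, hn⟩ : ∃ n : Fin d → ℝ, ∀ k, n k = (∑ j, x j * dda k j t x) * da k t x +
        (∑ j, x j * ddb k j t x) * db k t x := ⟨_, fun _ => rfl⟩
    obtain ⟨w, hw⟩ : ∃ w : Fin d → ℝ, ∀ k, w k = x k * (b' t x * da k t x + b t x * da' k t x -
        (a' t x * db k t x + a t x * db' k t x)) := ⟨_, fun _ => rfl⟩
    obtain ⟨p, hp⟩ : ∃ p, p = (a t x ^ 2 + b t x ^ 2) ^ σ := ⟨_, rfl⟩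
    have hmn : ∑ k, n k = ∑ k, m k := by
      simp only [hm, hn, Finset.sum_mul, Finset.mul_sum, ← Finset.sum_add_distrib]
      rw [Finset.sum_comm]
      refine Finset.sum_congr rfl fun j _ => Finset.sum_congr rfl fun k _ => ?_
      rw [ha.symm k j, hb.symm k j]
      ring
    simp only [← hw, ← hq, ← hp] at h₁ h₂ ⊢
    have hD : ∀ k, (b t x * a' t x - a t x * b' t x)
        + x k * (db k t x * a' t x + b t x * da' k t x - (da k t x * b' t x + a t x * db' k t x))
        - d * (da k t x ^ 2 + a t x * dda k k t x + (db k t x ^ 2 + b t x * ddb k k t x))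
        - 2 * ((da k t x + ∑ j, x j * dda k j t x) * da k t x +
            (∑ j, x j * da j t x) * dda k k t x +
          ((db k t x + ∑ j, x j * ddb k j t x) * db k t x +
            (∑ j, x j * db j t x) * ddb k k t x))
        + ∑ j, q j
        + x k * (2 * ∑ j, (da j t x * dda k j t x + db j t x * ddb k j t x))
        - lam / (σ + 1) * (p * (a t x ^ 2 + b t x ^ 2))
        - 2 * lam * (x k * (p * (a t x * da k t x + b t x * db k t x))) =
        (b t x * a' t x - a t x * b' t x + ∑ j, q j -
          lam / (σ + 1) * (p * (a t x ^ 2 + b t x ^ 2)))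
        + w k + (2 * a' t x - 2 * lam * p * b t x) * (x k * db k t x)
        - (2 * b' t x + 2 * lam * p * a t x) * (x k * da k t x)
        - (d + 2) * q k - (d * a t x + 2 * ∑ j, x j * da j t x) * dda k k t x
        - (d * b t x + 2 * ∑ j, x j * db j t x) * ddb k k t x
        - 2 * n k + 2 * m k := fun k => by
      rw [hw, hq k, hm, hn]
      ring
    rw [Finset.sum_congr rfl fun k _ => hD k]
    simp only [Finset.sum_add_distrib, Finset.sum_sub_distrib, ← Finset.mul_sum,
      Finset.sum_const, Finset.card_univ, Fintype.card_fin, nsmul_eq_mul, hmn]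
    have h₃ : lam * σ / (σ + 1) = lam - lam / (σ + 1) := by
      field_simp
      ring
    rw [show (d : ℝ) * lam * σ / (σ + 1) = d * (lam - lam / (σ + 1)) by rw [← h₃]; ring]
    linear_combination (-(d * b t x) - 2 * ∑ j, x j * db j t x) * h₁ +
      (d * a t x + 2 * ∑ j, x j * da j t x) * h₂

end RealSystem

lemma variance_bound_of_momentum_bound {V G g : ℝ → ℝ} {h T : ℝ} (hT : 0 ≤ T)
    (hVc : ContinuousOn V (Set.Icc 0 T)) (hGc : ContinuousOn G (Set.Icc 0 T))
    (hV : ∀ t ∈ Set.Ioo 0 T, HasDerivAt V (4 * G t) t)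
    (hG : ∀ t ∈ Set.Ioo 0 T, HasDerivAt G (g t) t) (hg : ∀ t ∈ Set.Ioo 0 T, g t ≤ 4 * h) :
    V T ≤ V 0 + 4 * T * G 0 + 8 * T ^ 2 * h := by
  have hG' : AntitoneOn (fun t => G t - 4 * h * t) (Set.Icc 0 T) := by
    have hd : ∀ t ∈ Set.Ioo 0 T, HasDerivAt (fun t => G t - 4 * h * t) (g t - 4 * h) t :=
      fun t ht => ((hG t ht).fun_sub ((hasDerivAt_id t).const_mul (4 * h))).congr_deriv (by simp)
    refine antitoneOn_of_deriv_nonpos (convex_Icc 0 T) (hGc.sub (by fun_prop)) ?_ ?_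
    · rw [interior_Icc]
      exact fun t ht => (hd t ht).differentiableAt.differentiableWithinAt
    · rw [interior_Icc]
      intro t ht
      rw [(hd t ht).deriv]
      linarith [hg t ht]
  have hV' : AntitoneOn (fun t => V t - (4 * G 0 * t + 8 * h * t ^ 2)) (Set.Icc 0 T) := by
    have hd : ∀ t ∈ Set.Ioo 0 T, HasDerivAt (fun t => V t - (4 * G 0 * t + 8 * h * t ^ 2))
        (4 * G t - (4 * G 0 + 16 * h * t)) t := fun t ht =>
      ((hV t ht).fun_sub (((hasDerivAt_id t).const_mul (4 * G 0)).fun_add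
        (((hasDerivAt_id t).fun_pow 2).const_mul (8 * h)))).congr_deriv (by simp; ring)
    refine antitoneOn_of_deriv_nonpos (convex_Icc 0 T) (hVc.sub (by fun_prop)) ?_ ?_
    · rw [interior_Icc]
      exact fun t ht => (hd t ht).differentiableAt.differentiableWithinAt
    · rw [interior_Icc]
      intro t ht
      rw [(hd t ht).deriv]
      have := hG' (Set.left_mem_Icc.2 hT) (Set.Ioo_subset_Icc_self ht) ht.1.le
      simp only [mul_zero, sub_zero] at this
      linarith
  have := hV' (Set.left_mem_Icc.2 hT) (Set.right_mem_Icc.2 hT) hT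
  simp only at this
  linarith

section Slices

variable {E F : Type*} [NormedAddCommGroup E] [NormedSpace ℝ E] [NormedAddCommGroup F]
  [NormedSpace ℝ F] {f : ℝ × E → F} {t : ℝ} {x : E}

lemma DifferentiableAt.hasDerivAt_slice (hf : DifferentiableAt ℝ f (t, x)) :
    HasDerivAt (fun s => f (s, x)) (fderiv ℝ f (t, x) (1, 0)) t :=
  hf.hasFDerivAt.comp_hasDerivAt t ((hasDerivAt_id t).prodMk (hasDerivAt_const t x))

lemma DifferentiableAt.hasFDerivAt_slice (hf : DifferentiableAt ℝ f (t, x)) :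
    HasFDerivAt (fun y => f (t, y))
      ((fderiv ℝ f (t, x)).comp (ContinuousLinearMap.inr ℝ ℝ E)) x :=
  hf.hasFDerivAt.comp x (hasFDerivAt_prodMk_right t x)

lemma DifferentiableAt.hasLineDerivAt_slice (hf : DifferentiableAt ℝ f (t, x)) (L : F →L[ℝ] ℝ)
    (v : E) : HasLineDerivAt ℝ (fun y => L (f (t, y))) (L (fderiv ℝ f (t, x) (0, v))) x v := by
  simpa [Function.comp_def] using
    (L.hasFDerivAt.comp x hf.hasFDerivAt_slice).hasLineDerivAt v

lemma ContDiff.fderiv_apply_const (hf : ContDiff ℝ (⊤ : ℕ∞) f) (v : ℝ × E) :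
    ContDiff ℝ (⊤ : ℕ∞) (fun p => fderiv ℝ f p v) :=
  (hf.fderiv_right (by simp)).clm_apply contDiff_const

lemma ContDiff.fderiv_fderiv_comm (hf : ContDiff ℝ (⊤ : ℕ∞) f) (p v w : ℝ × E) :
    fderiv ℝ (fun q => fderiv ℝ f q v) p w = fderiv ℝ (fun q => fderiv ℝ f q w) p v := by
  have hf₂ : ContDiff ℝ 2 f := contDiff_infty.1 hf 2
  have hd : DifferentiableAt ℝ (fderiv ℝ f) p :=
    (hf₂.fderiv_right (m := 1) (by norm_num)).differentiable (by simp) p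
  have h : ∀ v w, fderiv ℝ (fun q => fderiv ℝ f q v) p w = fderiv ℝ (fderiv ℝ f) p w v :=
    fun v w => by rw [fderiv_clm_apply hd (differentiableAt_const v)]; simp
  rw [h, h]
  exact hf₂.contDiffAt.isSymmSndFDerivAt (by simp) w v

end Slices

section Jet

variable {T : ℝ} {u : ℝ × EuclideanSpace ℝ (Fin d) → ℂ}

lemma pd_slice (hu : ContDiff ℝ (⊤ : ℕ∞) u) (k : Fin d) (t : ℝ)
    (x : EuclideanSpace ℝ (Fin d)) :
    pd (fun y => u (t, y)) k x = fderiv ℝ u (t, x) (0, EuclideanSpace.single k 1) := by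
  rw [pd, (hu.differentiable (by simp) (t, x)).hasFDerivAt_slice.fderiv]
  simp

lemma pd2_slice (hu : ContDiff ℝ (⊤ : ℕ∞) u) (j k : Fin d) (t : ℝ)
    (x : EuclideanSpace ℝ (Fin d)) :
    pd2 (fun y => u (t, y)) j k x =
      fderiv ℝ (fun p => fderiv ℝ u p (0, EuclideanSpace.single k 1)) (t, x)
        (0, EuclideanSpace.single j 1) := by
  rw [← pd_slice (hu.fderiv_apply_const _)]
  simp only [← pd_slice hu]
  rfl

lemma deriv_slice (hu : ContDiff ℝ (⊤ : ℕ∞) u) (t : ℝ) (x : EuclideanSpace ℝ (Fin d)) :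
    deriv (fun s => u (s, x)) t = fderiv ℝ u (t, x) (1, 0) :=
  (hu.differentiable (by simp) (t, x)).hasDerivAt_slice.deriv

lemma norm_pd_le (v : EuclideanSpace ℝ (Fin d) → ℂ) (k : Fin d)
    (x : EuclideanSpace ℝ (Fin d)) : ‖pd v k x‖ ≤ ‖iteratedFDeriv ℝ 1 v x‖ := by
  rw [norm_iteratedFDeriv_one]
  simpa [pd] using (fderiv ℝ v x).le_opNorm (EuclideanSpace.single k 1)

lemma norm_pd2_le {v : EuclideanSpace ℝ (Fin d) → ℂ} (hv : ContDiff ℝ 2 v) (j k : Fin d)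
    (x : EuclideanSpace ℝ (Fin d)) : ‖pd2 v j k x‖ ≤ ‖iteratedFDeriv ℝ 2 v x‖ := by
  have hd : DifferentiableAt ℝ (fderiv ℝ v) x :=
    (hv.fderiv_right (m := 1) (by norm_num)).differentiable (by simp) x
  have h : pd2 v j k x =
      iteratedFDeriv ℝ 2 v x ![EuclideanSpace.single j 1, EuclideanSpace.single k 1] := by
    rw [iteratedFDeriv_two_apply, pd2, fderiv_clm_apply hd (differentiableAt_const _)]
    simp
  rw [h]
  simpa [Fin.prod_univ_two] using (iteratedFDeriv ℝ 2 v x).le_opNorm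
    ![EuclideanSpace.single j 1, EuclideanSpace.single k 1]

lemma UniformDecay.of_norm_le {f : ℝ × EuclideanSpace ℝ (Fin d) → ℂ} {L : ℂ →L[ℝ] ℝ}
    (hL : ∀ z, |L z| ≤ ‖z‖) (hf : Continuous f) {B : ℝ → EuclideanSpace ℝ (Fin d) → ℝ}
    (hfB : ∀ t x, ‖f (t, x)‖ ≤ B t x)
    (hB : ∀ k : ℕ, ∃ C : ℝ, ∀ t ∈ Set.Icc 0 T, ∀ x, (1 + ‖x‖) ^ k * B t x ≤ C) :
    UniformDecay T (fun t x => L (f (t, x))) where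
  continuous t _ := by fun_prop
  decay k := by
    obtain ⟨C, hC⟩ := hB k
    refine ⟨C, fun t ht x => le_trans ?_ (hC t ht x)⟩
    gcongr
    exact (hL _).trans (hfB t x)

lemma decayingJet_comp (hu : ContDiff ℝ (⊤ : ℕ∞) u) (hr : RapidlyDecreasingOn T u)
    {L : ℂ →L[ℝ] ℝ} (hL : ∀ z, |L z| ≤ ‖z‖) :
    DecayingJet T (fun t x => L (u (t, x))) (fun k t x => L (pd (fun y => u (t, y)) k x))
      (fun j k t x => L (pd2 (fun y => u (t, y)) j k x))
      (fun t x => L (deriv (fun s => u (s, x)) t))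
      (fun k t x => L (pd (fun y => deriv (fun s => u (s, y)) t) k x)) := by
  have hu' := hu.fderiv_apply_const (1, 0)
  have hB : ∀ n k : ℕ, ∃ C : ℝ, ∀ t ∈ Set.Icc 0 T, ∀ x,
      (1 + ‖x‖) ^ k * ‖iteratedFDeriv ℝ n (fun y => u (t, y)) x‖ ≤ C := fun n k =>
    (hr n k).imp fun C hC t ht x => (hC t ht x).1
  have hB' : ∀ n k : ℕ, ∃ C : ℝ, ∀ t ∈ Set.Icc 0 T, ∀ x,
      (1 + ‖x‖) ^ k * ‖iteratedFDeriv ℝ n (fun y => fderiv ℝ u (t, y) (1, 0)) x‖ ≤ C :=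
    fun n k => (hr n k).imp fun C hC t ht x => by simpa only [deriv_slice hu] using (hC t ht x).2
  simp only [deriv_slice hu]
  refine ⟨?_, fun k => ?_, fun j k => ?_, ?_, fun k => ?_, fun t x => ?_, fun k t x => ?_,
    fun k t x => ?_, fun j k t x => ?_, fun k t x => ?_, fun j k t x => ?_⟩
  · exact .of_norm_le hL hu.continuous
      (B := fun t x => ‖iteratedFDeriv ℝ 0 (fun y => u (t, y)) x‖)
      (fun t x => by rw [norm_iteratedFDeriv_zero]) (hB 0)
  · simp only [pd_slice hu]
    refine .of_norm_le hL (hu.fderiv_apply_const _).continuous (fun t x => ?_) (hB 1)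
    rw [← pd_slice hu]
    exact norm_pd_le _ k x
  · simp only [pd2_slice hu]
    refine .of_norm_le hL ((hu.fderiv_apply_const _).fderiv_apply_const _).continuous
      (fun t x => ?_) (hB 2)
    rw [← pd2_slice hu]
    exact norm_pd2_le ((contDiff_infty.1 hu 2).comp (by fun_prop)) j k x
  · exact .of_norm_le hL hu'.continuous
      (B := fun t x => ‖iteratedFDeriv ℝ 0 (fun y => fderiv ℝ u (t, y) (1, 0)) x‖)
      (fun t x => by rw [norm_iteratedFDeriv_zero]) (hB' 0)
  · simp only [pd_slice hu']
    refine .of_norm_le hL (hu'.fderiv_apply_const _).continuous (fun t x => ?_) (hB' 1)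
    rw [← pd_slice hu']
    exact norm_pd_le _ k x
  · exact L.hasFDerivAt.comp_hasDerivAt t (hu.differentiable (by simp) (t, x)).hasDerivAt_slice
  · simp only [pd_slice hu, pd_slice hu']
    rw [hu.fderiv_fderiv_comm]
    exact L.hasFDerivAt.comp_hasDerivAt t
      ((hu.fderiv_apply_const _).differentiable (by simp) (t, x)).hasDerivAt_slice
  · rw [pd_slice hu]
    exact (hu.differentiable (by simp) (t, x)).hasLineDerivAt_slice L _
  · simp only [pd_slice hu, pd2_slice hu]
    exact ((hu.fderiv_apply_const _).differentiable (by simp) (t, x)).hasLineDerivAt_slice L _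
  · rw [pd_slice hu']
    exact (hu'.differentiable (by simp) (t, x)).hasLineDerivAt_slice L _
  · rw [pd2_slice hu, pd2_slice hu, hu.fderiv_fderiv_comm]

end Jet

lemma norm_sq_eq_re_sq_add_im_sq (z : ℂ) : ‖z‖ ^ 2 = z.re ^ 2 + z.im ^ 2 := by
  rw [Complex.sq_norm, Complex.normSq_apply]
  ring

lemma norm_rpow_two_mul (z : ℂ) (σ : ℝ) : ‖z‖ ^ (2 * σ) = (z.re ^ 2 + z.im ^ 2) ^ σ := by
  rw [← norm_sq_eq_re_sq_add_im_sq, Real.rpow_mul (norm_nonneg z), Real.rpow_two]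

lemma norm_rpow_two_mul_add_two (z : ℂ) {σ : ℝ} (hσ : 0 ≤ σ) :
    ‖z‖ ^ (2 * σ + 2) = (z.re ^ 2 + z.im ^ 2) ^ σ * (z.re ^ 2 + z.im ^ 2) := by
  rw [← norm_rpow_two_mul, ← norm_sq_eq_re_sq_add_im_sq, Real.rpow_add_of_nonneg (norm_nonneg z)
    (by positivity) (by norm_num), Real.rpow_two]

/-- The variance inequality for smooth decaying solutions of the critical or supercritical
nonlinear Schrödinger equation. -/
theorem varV_le_of_isNLSSolution {σ lam T : ℝ} (hσ : 0 ≤ σ) (hdσ : 2 ≤ d * σ) (hlam : 0 ≤ lam)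
    (hT : 0 ≤ T) {u : ℝ × EuclideanSpace ℝ (Fin d) → ℂ} (hu : ContDiff ℝ (⊤ : ℕ∞) u)
    (hr : RapidlyDecreasingOn T u) (hs : IsNLSSolution σ lam T u) :
    varV (fun x => u (T, x)) ≤ varV (fun x => u (0, x)) + 4 * T * momG (fun x => u (0, x)) +
      8 * T ^ 2 * energyH σ lam (fun x => u (0, x)) := by
  have ha := decayingJet_comp hu hr (L := reCLM) Complex.abs_re_le_norm
  have hb := decayingJet_comp hu hr (L := imCLM) Complex.abs_im_le_norm
  simp only [reCLM_apply, imCLM_apply] at ha hb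
  have hat : ∀ t ∈ Set.Icc 0 T, ∀ x, (deriv (fun s => u (s, x)) t).re =
      ∑ k, (pd2 (fun y => u (t, y)) k k x).im +
        lam * ((u (t, x)).re ^ 2 + (u (t, x)).im ^ 2) ^ σ * (u (t, x)).im := fun t ht x => by
    have := congrArg Complex.im (hs t ht x)
    rw [norm_rpow_two_mul] at this
    simpa [lap] using this
  have hbt : ∀ t ∈ Set.Icc 0 T, ∀ x, (deriv (fun s => u (s, x)) t).im =
      -(∑ k, (pd2 (fun y => u (t, y)) k k x).re +
        lam * ((u (t, x)).re ^ 2 + (u (t, x)).im ^ 2) ^ σ * (u (t, x)).re) := fun t ht x => by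
    have := congrArg Complex.re (hs t ht x)
    rw [norm_rpow_two_mul] at this
    rw [← neg_eq_iff_eq_neg]
    simpa [lap] using this
  obtain ⟨hVc, hV⟩ := variance_law ha hb
    (R := fun t x => lam * ((u (t, x)).re ^ 2 + (u (t, x)).im ^ 2) ^ σ) hat hbt
  obtain ⟨hEc, hE⟩ := energy_law hσ ha hb hat hbt
  obtain ⟨hGc, hG⟩ := momentum_law hσ ha hb hat hbt
  simp only [integral_const_mul] at hV
  have hQ : UniformDecay T (fun t x => ∑ k, ((pd (fun y => u (t, y)) k x).re ^ 2 +
      (pd (fun y => u (t, y)) k x).im ^ 2)) :=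
    .sum fun k => (ha.decay_grad k).pow_two.add (hb.decay_grad k).pow_two
  have hP := (ha.decay.pow_two.add hb.decay.pow_two).rpow_mul_self
    (fun _ _ _ => by positivity) hσ
  have h₀ : (0 : ℝ) ∈ Set.Icc 0 T := Set.left_mem_Icc.2 hT
  have hVeq : ∀ t, varV (fun x => u (t, x)) =
      ∫ x, ‖x‖ ^ 2 * ((u (t, x)).re ^ 2 + (u (t, x)).im ^ 2) := fun t => by
    simp only [varV, norm_sq_eq_re_sq_add_im_sq]
  have hHeq : energyH σ lam (fun x => u (0, x)) =
      ∫ x, ((1 / 2) * (∑ k, ((pd (fun y => u (0, y)) k x).re ^ 2 +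
        (pd (fun y => u (0, y)) k x).im ^ 2)) - lam / (2 * σ + 2) *
          (((u (0, x)).re ^ 2 + (u (0, x)).im ^ 2) ^ σ *
            ((u (0, x)).re ^ 2 + (u (0, x)).im ^ 2))) := by
    rw [integral_sub ((hQ.integrable h₀).const_mul _) ((hP.integrable h₀).const_mul _),
      integral_const_mul, integral_const_mul]
    simp only [energyH, norm_sq_eq_re_sq_add_im_sq, norm_rpow_two_mul_add_two _ hσ]
  have hGeq : momG (fun x => u (0, x)) =
      ∫ x, ∑ k, x k * ((u (0, x)).im * (pd (fun y => u (0, y)) k x).re -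
        (u (0, x)).re * (pd (fun y => u (0, y)) k x).im) := by
    have him : ∀ x : EuclideanSpace ℝ (Fin d), (u (0, x) * ∑ k, (x k : ℂ) *
        (starRingEnd ℂ) (pd (fun y => u (0, y)) k x)).im =
        ∑ k, x k * ((u (0, x)).im * (pd (fun y => u (0, y)) k x).re -
        (u (0, x)).re * (pd (fun y => u (0, y)) k x).im) := fun x => by
      rw [Finset.mul_sum, Complex.im_sum]
      refine Finset.sum_congr rfl fun k _ => ?_
      simp
      ring
    have hre : ∀ x : EuclideanSpace ℝ (Fin d), (u (0, x) * ∑ k, (x k : ℂ) *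
        (starRingEnd ℂ) (pd (fun y => u (0, y)) k x)).re =
        ∑ k, x k * ((u (0, x)).re * (pd (fun y => u (0, y)) k x).re +
        (u (0, x)).im * (pd (fun y => u (0, y)) k x).im) := fun x => by
      rw [Finset.mul_sum, Complex.re_sum]
      refine Finset.sum_congr rfl fun k _ => ?_
      simp
      ring
    have hint : Integrable fun x : EuclideanSpace ℝ (Fin d) => u (0, x) * ∑ k, (x k : ℂ) *
        (starRingEnd ℂ) (pd (fun y => u (0, y)) k x) := by
      refine Integrable.re_im_iff.1 ⟨?_, ?_⟩
      · refine (UniformDecay.integrable (T := T) (.sum fun k => ((ha.decay.mul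
          (ha.decay_grad k)).add (hb.decay.mul (hb.decay_grad k))).coord_mul k) h₀).congr
          (.of_forall fun x => (hre x).symm)
      · refine (UniformDecay.integrable (T := T) (.sum fun k => ((hb.decay.mul
          (ha.decay_grad k)).sub (ha.decay.mul (hb.decay_grad k))).coord_mul k) h₀).congr
          (.of_forall fun x => (him x).symm)
    calc momG (fun x => u (0, x)) = ∫ x : EuclideanSpace ℝ (Fin d), (u (0, x) * ∑ k, (x k : ℂ) *
        (starRingEnd ℂ) (pd (fun y => u (0, y)) k x)).im := (integral_im hint).symm
      _ = _ := by simp only [him]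
  rw [hVeq, hVeq, hGeq, hHeq]
  refine variance_bound_of_momentum_bound hT hVc hGc hV hG fun t ht => ?_
  have ht' := Set.Ioo_subset_Icc_self ht
  have hmono := antitoneOn_of_deriv_nonpos (convex_Icc 0 T) hEc
    (by
      rw [interior_Icc]
      exact fun t ht => (hE t ht).differentiableAt.differentiableWithinAt)
    (by
      rw [interior_Icc]
      intro t ht
      rw [(hE t ht).deriv, integral_zero])
    h₀ ht' ht.1.le
  have hPE : d * lam * σ / (σ + 1) ≥ 4 * (lam / (2 * σ + 2)) := by
    rw [ge_iff_le, ← mul_div_assoc, div_le_div_iff₀ (by positivity) (by positivity)]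
    nlinarith [mul_le_mul_of_nonneg_left hdσ (by positivity : 0 ≤ lam * (σ + 1))]
  refine le_trans ?_ (mul_le_mul_of_nonneg_left hmono (by norm_num : (0 : ℝ) ≤ 4))
  rw [← integral_const_mul]
  refine integral_mono (((hQ.const_mul _).sub (hP.const_mul _)).integrable ht')
    ((((hQ.const_mul _).sub (hP.const_mul _)).const_mul 4).integrable ht') fun x => ?_
  have := mul_le_mul_of_nonneg_right hPE (by positivity :
    0 ≤ ((u (t, x)).re ^ 2 + (u (t, x)).im ^ 2) ^ σ *
      ((u (t, x)).re ^ 2 + (u (t, x)).im ^ 2))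
  simp only
  linarith

/-- Glassey blow-up (nonexistence of global smooth decaying solutions) for the critical
and supercritical nonlinear Schrödinger equation, used in the proof of Proposition 5.2:
if `V(u₀) + 4T G(u₀) + 8T² H_{σ̃,λ}(u₀) < 0` then there is no smooth, rapidly decreasing
classical solution of `i ∂_t u = Δu + λ|u|^{2σ̃}u` on `[0,T]` with initial data `u₀`. -/
theorem glassey_blowup_NLS
    (hd : 1 ≤ d) {σt lam : ℝ} (hσt : 2 / (d : ℝ) ≤ σt) (hlam : 0 ≤ lam)
    {T : ℝ} (hT : 0 < T)
    (u₀ : SchwartzMap (EuclideanSpace ℝ (Fin d)) ℂ)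
    (hneg : varV (⇑u₀) + 4 * T * momG (⇑u₀) + 8 * T ^ 2 * energyH σt lam (⇑u₀) < 0) :
    ¬ ∃ u : ℝ × EuclideanSpace ℝ (Fin d) → ℂ,
        ContDiff ℝ (⊤ : ℕ∞) u ∧ RapidlyDecreasingOn T u ∧ IsNLSSolution σt lam T u ∧
        ∀ x, u (0, x) = u₀ x := by
  rintro ⟨u, hu, hr, hs, h₀⟩
  have hd' : (0 : ℝ) < d := by exact_mod_cast hd
  have hσ : 0 ≤ σt := (by positivity : (0 : ℝ) ≤ 2 / d).trans hσt
  have hdσ : 2 ≤ d * σt := by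
    rwa [div_le_iff₀ hd', mul_comm] at hσt
  have h := varV_le_of_isNLSSolution hσ hdσ hlam hT.le hu hr hs
  rw [show (fun x => u (0, x)) = ⇑u₀ from funext h₀] at h
  have hV : 0 ≤ varV (fun x => u (T, x)) := integral_nonneg fun x => by positivity
  linarith
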